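/- Let f : ℝ^d → ℝ be convex and L-smooth with minimizer x* and minimal value f*. Fix points x_k, z_k ∈ ℝ^d, α_k ∈ (0, 1], set y_k = α_k z_k + (1 − α_k) x_k and γ_k = 1/(2 ρ α_k), and let g be a random vector with E[‖g‖²] ≤ ρ‖∇f(y_k)‖² + σ². Define x_{k+1} = y_k − η g and z_{k+1} = z_k − γ_k η g with 0 < η ≤ 1/(2ρL), and let δ_k = ‖E[g] − ∇f(y_k)‖. Then E[‖z_{k+1} − x*‖²] ≤ ‖z_k − x*‖² + 2 γ_k² η² σ² − 4 γ_k² η ρ E[f(x_{k+1})] + 2 γ_k η f* + 2 γ_k η ((1 − α_k)/α_k) f(x_k) + 2 γ_k η ‖z_k − x*‖ δ_k + 2 γ_k² η² ρ δ_k². -/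

import Mathlib

open MeasureTheory
open scoped RealInnerProductSpace

/-- First-order characterization of convexity: the graph lies above its tangent hyperplanes. -/
theorem ConvexOn.add_inner_gradient_le {E : Type*} [NormedAddCommGroup E] [InnerProductSpace ℝ E]
    [CompleteSpace E] {f : E → ℝ} (hf : ConvexOn ℝ Set.univ f) {u : E}
    (hd : DifferentiableAt ℝ f u) (v : E) :
    f u + ⟪gradient f u, v - u⟫ ≤ f v := by
  have hline : ConvexOn ℝ Set.univ (f ∘ AffineMap.lineMap (k := ℝ) u v) := by
    simpa using hf.comp_affineMap (AffineMap.lineMap (k := ℝ) u v)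
  have hderiv : HasDerivAt (f ∘ AffineMap.lineMap (k := ℝ) u v)
      ⟪gradient f u, v - u⟫ 0 := by
    have hg : HasFDerivAt f (InnerProductSpace.toDual ℝ E (gradient f u))
        (AffineMap.lineMap u v (0 : ℝ)) := by
      simpa using hd.hasGradientAt.hasFDerivAt
    exact hg.comp_hasDerivAt (0 : ℝ) AffineMap.hasDerivAt_lineMap
  have h := hline.le_slope_of_hasDerivAt (Set.mem_univ 0) (Set.mem_univ 1) one_pos hderiv
  simp only [slope_def_field, Function.comp_apply, AffineMap.lineMap_apply_zero, AffineMap.lineMap_apply_one,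
    sub_zero, div_one] at h
  linarith

/-- Integral of a quadratic polynomial in a random vector. -/
theorem integral_sub_inner_add_norm_sq {E Ω : Type*} [NormedAddCommGroup E]
    [InnerProductSpace ℝ E] [CompleteSpace E] [MeasurableSpace Ω] {μ : Measure Ω}
    [IsProbabilityMeasure μ] {g : Ω → E} (hg : Integrable g μ)
    (hg2 : Integrable (fun ω => ‖g ω‖ ^ 2) μ) (p : E) (a b c : ℝ) :
    Integrable (fun ω => a - b * ⟪p, g ω⟫ + c * ‖g ω‖ ^ 2) μ ∧
      ∫ ω, (a - b * ⟪p, g ω⟫ + c * ‖g ω‖ ^ 2) ∂μ =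
        a - b * ⟪p, ∫ ω, g ω ∂μ⟫ + c * ∫ ω, ‖g ω‖ ^ 2 ∂μ := by
  have hi : Integrable (fun ω => b * ⟪p, g ω⟫) μ := (hg.const_inner p).const_mul b
  have hsub : Integrable (fun ω => a - b * ⟪p, g ω⟫) μ := (integrable_const a).sub hi
  refine ⟨hsub.add (hg2.const_mul c), ?_⟩
  rw [integral_add hsub (hg2.const_mul c), integral_sub (integrable_const a) hi,
    integral_const_mul, integral_const_mul, integral_inner hg]
  simp

/-- Expected squared distance to `c` after a random step from `a` in the direction `-g`. -/
theorem integral_norm_sub_smul_sub_sq {E Ω : Type*} [NormedAddCommGroup E]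
    [InnerProductSpace ℝ E] [CompleteSpace E] [MeasurableSpace Ω] {μ : Measure Ω}
    [IsProbabilityMeasure μ] {g : Ω → E} (hg : Integrable g μ)
    (hg2 : Integrable (fun ω => ‖g ω‖ ^ 2) μ) (a c : E) (t : ℝ) :
    ∫ ω, ‖a - t • g ω - c‖ ^ 2 ∂μ =
      ‖a - c‖ ^ 2 - 2 * t * ⟪a - c, ∫ ω, g ω ∂μ⟫ + t ^ 2 * ∫ ω, ‖g ω‖ ^ 2 ∂μ := by
  have hexp : ∀ ω, ‖a - t • g ω - c‖ ^ 2 =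
      ‖a - c‖ ^ 2 - 2 * t * ⟪a - c, g ω⟫ + t ^ 2 * ‖g ω‖ ^ 2 := fun ω => by
    rw [sub_right_comm, norm_sub_sq_real, inner_smul_right, norm_smul, mul_pow, Real.norm_eq_abs,
      sq_abs]
    ring
  simp_rw [hexp]
  exact (integral_sub_inner_add_norm_sq hg hg2 _ _ _ _).2

/-- Descent in expectation along a random step, from a quadratic upper bound at `y`. -/
theorem integral_sub_smul_le_of_quadratic_bound {E Ω : Type*} [NormedAddCommGroup E]
    [InnerProductSpace ℝ E] [CompleteSpace E] [MeasurableSpace Ω] {μ : Measure Ω}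
    [IsProbabilityMeasure μ] {f : E → ℝ} {y p : E} {L : ℝ}
    (hf : ∀ v, f v ≤ f y + ⟪p, v - y⟫ + L / 2 * ‖v - y‖ ^ 2)
    {g : Ω → E} (hg : Integrable g μ) (hg2 : Integrable (fun ω => ‖g ω‖ ^ 2) μ) (η : ℝ)
    (hfg : Integrable (fun ω => f (y - η • g ω)) μ) :
    ∫ ω, f (y - η • g ω) ∂μ ≤
      f y - η * ⟪p, ∫ ω, g ω ∂μ⟫ + L / 2 * η ^ 2 * ∫ ω, ‖g ω‖ ^ 2 ∂μ := by
  have hle : ∀ ω, f (y - η • g ω) ≤ f y - η * ⟪p, g ω⟫ + L / 2 * η ^ 2 * ‖g ω‖ ^ 2 := fun ω => by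
    have h := hf (y - η • g ω)
    rw [sub_sub_cancel_left, inner_neg_right, inner_smul_right, norm_neg, norm_smul, mul_pow,
      Real.norm_eq_abs, sq_abs] at h
    linarith
  obtain ⟨hint, heq⟩ := integral_sub_inner_add_norm_sq hg hg2 p (f y) η (L / 2 * η ^ 2)
  exact (integral_mono hfg hint hle).trans_eq heq

/-- One-step distance recursion of Nesterov-accelerated SGD in the convex case:
with `y_k = α_k z_k + (1 - α_k) x_k`, `γ_k = 1/(2ρα_k)`, a stochastic gradient `g`
with `E[‖g‖²] ≤ ρ‖∇f(y_k)‖² + σ²`, steps `x_{k+1} = y_k - η g`,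
`z_{k+1} = z_k - γ_k η g`, `0 < η ≤ 1/(2ρL)`, and bias `δ_k = ‖E[g] - ∇f(y_k)‖`,
one has `E[‖z_{k+1} - x*‖²] ≤ ‖z_k - x*‖² + 2γ_k²η²σ² - 4γ_k²ηρ E[f(x_{k+1})]
+ 2γ_kη f* + 2γ_kη((1-α_k)/α_k) f(x_k) + 2γ_kη‖z_k - x*‖δ_k + 2γ_k²η²ρδ_k²`. -/
theorem stmt7 (d : ℕ) (f : EuclideanSpace ℝ (Fin d) → ℝ) (L ρ σ2 η αk γk : ℝ)
    (hL : 0 < L) (hρ : 0 < ρ) (hσ : 0 ≤ σ2)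
    (hconv : ConvexOn ℝ Set.univ f)
    (hdiff : Differentiable ℝ f)
    (hsmooth : ∀ u v : EuclideanSpace ℝ (Fin d),
      f v ≤ f u + ⟪gradient f u, v - u⟫ + L / 2 * ‖v - u‖ ^ 2)
    (xstar : EuclideanSpace ℝ (Fin d)) (fstar : ℝ)
    (hmin : ∀ u, f xstar ≤ f u) (hfstar : fstar = f xstar)
    (xk zk yk : EuclideanSpace ℝ (Fin d))
    (hαk : 0 < αk) (hαk1 : αk ≤ 1)
    (hyk : yk = αk • zk + (1 - αk) • xk)
    (hγk : γk = 1 / (2 * ρ * αk))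
    (Ω : Type) [MeasureSpace Ω] (hP : IsProbabilityMeasure (volume : Measure Ω))
    (g : Ω → EuclideanSpace ℝ (Fin d))
    (hgInt : Integrable g)
    (hg2 : Integrable (fun ω => ‖g ω‖ ^ 2))
    (hmom : (∫ ω, ‖g ω‖ ^ 2) ≤ ρ * ‖gradient f yk‖ ^ 2 + σ2)
    (hη0 : 0 < η) (hη : η ≤ 1 / (2 * ρ * L))
    (x' z' : Ω → EuclideanSpace ℝ (Fin d))
    (hx' : ∀ ω, x' ω = yk - η • g ω)
    (hz' : ∀ ω, z' ω = zk - (γk * η) • g ω)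
    (hfInt : Integrable (fun ω => f (x' ω)))
    (δk : ℝ) (hδk : δk = ‖(∫ ω, g ω) - gradient f yk‖) :
    (∫ ω, ‖z' ω - xstar‖ ^ 2) ≤
      ‖zk - xstar‖ ^ 2 + 2 * γk ^ 2 * η ^ 2 * σ2
        - 4 * γk ^ 2 * η * ρ * (∫ ω, f (x' ω))
        + 2 * γk * η * fstar
        + 2 * γk * η * ((1 - αk) / αk) * f xk
        + 2 * γk * η * ‖zk - xstar‖ * δk
        + 2 * γk ^ 2 * η ^ 2 * ρ * δk ^ 2 := by
  simp_rw [hx'] at hfInt ⊢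
  simp_rw [hz']
  rw [integral_norm_sub_smul_sub_sq hgInt hg2]
  have hdescent := integral_sub_smul_le_of_quadratic_bound (hsmooth yk) hgInt hg2 η hfInt
  have hM0 : 0 ≤ ∫ ω, ‖g ω‖ ^ 2 := integral_nonneg fun ω => sq_nonneg _
  have hstar := hconv.add_inner_gradient_le (hdiff yk) xstar
  have hxk := hconv.add_inner_gradient_le (hdiff yk) xk
  generalize (∫ ω, f (yk - η • g ω)) = F at *
  generalize (∫ ω, ‖g ω‖ ^ 2) = M at *
  generalize (∫ ω, g ω) = m at *
  generalize gradient f yk = p at *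
  obtain ⟨b, rfl⟩ : ∃ b, m = p + b := ⟨m - p, by abel⟩
  rw [add_sub_cancel_left] at hδk
  have hγ : 0 < γk := by rw [hγk]; positivity
  have hγα : 2 * ρ * γk = 1 / αk := by rw [hγk]; field_simp
  have hηL : ρ * L * η ≤ 1 / 2 := by
    rw [le_div_iff₀ (by positivity)] at hη
    linarith
  have hbias : -⟪zk - xstar, b⟫ ≤ ‖zk - xstar‖ * δk := by
    rw [hδk]
    exact (neg_le_abs _).trans (abs_real_inner_le_norm _ _)
  have hsq : 0 ≤ ‖p‖ ^ 2 + 2 * ⟪p, b⟫ + δk ^ 2 := by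
    rw [hδk, ← norm_add_sq_real]
    positivity
  have hlin : f yk / αk - fstar - (1 - αk) / αk * f xk ≤ ⟪zk - xstar, p⟫ := by
    have hz : zk - xstar = -(xstar - yk) - ((1 - αk) / αk) • (xk - yk) := by
      have h : zk = αk⁻¹ • (yk - (1 - αk) • xk) := by
        rw [hyk, add_sub_cancel_right, inv_smul_smul₀ hαk.ne']
      rw [h]
      match_scalars <;> field_simp
      ring
    have hr : 0 ≤ (1 - αk) / αk := div_nonneg (by linarith) hαk.le
    have h := mul_le_mul_of_nonneg_left hxk hr
    have hf : f yk / αk = f yk + (1 - αk) / αk * f yk := by field_simp; ring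
    rw [hz, real_inner_comm, inner_sub_right, inner_neg_right, inner_smul_right, hf, hfstar]
    linarith
  rw [inner_add_right] at hdescent ⊢
  rw [real_inner_self_eq_norm_sq] at hdescent
  have hlin' := mul_le_mul_of_nonneg_left hlin (by positivity : 0 ≤ 2 * γk * η)
  have hbias' := mul_le_mul_of_nonneg_left hbias (by positivity : 0 ≤ 2 * γk * η)
  have hdescent' := mul_le_mul_of_nonneg_left hdescent
    (by positivity : 0 ≤ 4 * γk ^ 2 * η * ρ)
  have hmom' := mul_le_mul_of_nonneg_left hmom (by positivity : 0 ≤ 2 * γk ^ 2 * η ^ 2)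
  have hsq' := mul_nonneg (by positivity : 0 ≤ 2 * γk ^ 2 * η ^ 2 * ρ) hsq
  have hηL' := mul_le_mul_of_nonneg_left hηL (by positivity : 0 ≤ 2 * γk ^ 2 * η ^ 2 * M)
  have hfy : 2 * γk * η * (f yk / αk) = 4 * γk ^ 2 * η * ρ * f yk := by
    rw [div_eq_mul_one_div, ← hγα]
    ring
  linarith
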